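/- Let Γ be a metric-compatible connection on the trivial bundle ℝⁿ × ℝᵐ with polynomial curvature growth, fix x₀ ∈ ℝⁿ, t₀ > 0, v ∈ ℝⁿ, τ ∈ ℝ, and let B be a smooth, compactly supported, skew-symmetric-matrix-valued 1-form. Set G₀(x) := (4πt₀)^{−n/2} e^{−|x−x₀|²/(4t₀)}. Then the function s ↦ ℱ_{x₀+sv, t₀+sτ}(Γ + sB) is differentiable at s = 0, with derivative equal to τ ∫_{ℝⁿ} (t₀·(4−n)/2 + |x−x₀|²/4) |F(x)|² G₀(x) dx + t₀ ∫_{ℝⁿ} (⟨v, x−x₀⟩/2) |F(x)|² G₀(x) dx + 4t₀² ∫_{ℝⁿ} ⟨B, D*F + ((x−x₀)/(2t₀)) ⌟ F⟩ G₀(x) dx. -/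

import Mathlib

open MeasureTheory Real Filter Matrix
open scoped ENNReal

noncomputable section

namespace YM

variable {n m : ℕ}

/-- A connection on the trivial bundle `ℝⁿ × ℝᵐ`, given by its coefficient
matrices `Γ₁(x), …, Γₙ(x)`. -/
abbrev Conn (n m : ℕ) :=
  (Fin n → ℝ) → Fin n → Matrix (Fin m) (Fin m) ℝ

/-- Entrywise `i`-th partial derivative of a matrix-valued map on `ℝⁿ`. -/
def pder (i : Fin n) (A : (Fin n → ℝ) → Matrix (Fin m) (Fin m) ℝ)
    (x : Fin n → ℝ) : Matrix (Fin m) (Fin m) ℝ :=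
  Matrix.of fun a b => fderiv ℝ (fun y => A y a b) x (Pi.single i 1)

/-- Smoothness (entrywise) of a matrix-valued map on `ℝⁿ`. -/
def SmoothMat (A : (Fin n → ℝ) → Matrix (Fin m) (Fin m) ℝ) : Prop :=
  ∀ a b, ContDiff ℝ (⊤ : ℕ∞) fun y => A y a b

/-- Smoothness of a connection. -/
def Smooth (Γ : Conn n m) : Prop :=
  ∀ i, SmoothMat fun x => Γ x i

/-- Matrix commutator. -/
def comm (A B : Matrix (Fin m) (Fin m) ℝ) : Matrix (Fin m) (Fin m) ℝ :=
  A * B - B * A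

/-- Curvature `F_{ij} = ∂ᵢΓⱼ − ∂ⱼΓᵢ + [Γᵢ, Γⱼ]`. -/
def curv (Γ : Conn n m) (i j : Fin n) (x : Fin n → ℝ) :
    Matrix (Fin m) (Fin m) ℝ :=
  pder i (fun y => Γ y j) x - pder j (fun y => Γ y i) x + comm (Γ x i) (Γ x j)

/-- Covariant derivative `∇ᵢA = ∂ᵢA + [Γᵢ, A]`. -/
def covDer (Γ : Conn n m) (i : Fin n)
    (A : (Fin n → ℝ) → Matrix (Fin m) (Fin m) ℝ) (x : Fin n → ℝ) :
    Matrix (Fin m) (Fin m) ℝ :=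
  pder i A x + comm (Γ x i) (A x)

/-- `(D*F)ₖ = −Σᵢ ∇ᵢF_{ik}`. -/
def dstarF (Γ : Conn n m) (k : Fin n) (x : Fin n → ℝ) :
    Matrix (Fin m) (Fin m) ℝ :=
  - ∑ i, covDer Γ i (fun y => curv Γ i k y) x

/-- Squared Frobenius norm of a matrix. -/
def frobSq (A : Matrix (Fin m) (Fin m) ℝ) : ℝ := ∑ a, ∑ b, (A a b) ^ 2

/-- Frobenius norm of a matrix. -/
def frobNorm (A : Matrix (Fin m) (Fin m) ℝ) : ℝ := Real.sqrt (frobSq A)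

/-- Frobenius inner product `⟨A, B⟩ = tr(A Bᵀ)`. -/
def frobInner (A B : Matrix (Fin m) (Fin m) ℝ) : ℝ := ∑ a, ∑ b, A a b * B a b

/-- `|F(x)|² = Σ_{i,j} ‖F_{ij}(x)‖²` (Frobenius norms). -/
def normSqF (Γ : Conn n m) (x : Fin n → ℝ) : ℝ :=
  ∑ i, ∑ j, frobSq (curv Γ i j x)

/-- `|F(x)|`. -/
def normF (Γ : Conn n m) (x : Fin n → ℝ) : ℝ := Real.sqrt (normSqF Γ x)

/-- Euclidean norm on `ℝⁿ`. -/
def enorm (x : Fin n → ℝ) : ℝ := Real.sqrt (∑ i, x i ^ 2)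

/-- Metric compatibility: all coefficient matrices are skew-symmetric. -/
def MetricCompat (Γ : Conn n m) : Prop :=
  ∀ x i, (Γ x i)ᵀ = -(Γ x i)

/-- `(x₀,t₀)`-soliton: `Σᵢ ∇ᵢF_{ik} = (1/(2t₀)) Σᵢ (x−x₀)ᵢ F_{ik}`. -/
def IsSolitonAt (Γ : Conn n m) (x₀ : Fin n → ℝ) (t₀ : ℝ) : Prop :=
  ∀ (x : Fin n → ℝ) (k : Fin n),
    ∑ i, covDer Γ i (fun y => curv Γ i k y) x
      = (1 / (2 * t₀)) • ∑ i, (x i - x₀ i) • curv Γ i k x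

/-- `(0,1)`-soliton. -/
def IsSoliton (Γ : Conn n m) : Prop := IsSolitonAt Γ 0 1

/-- The `ℱ`-functional
`ℱ_{x₀,t₀}(Γ) = t₀² (4πt₀)^{−n/2} ∫ |F|² e^{−|x−x₀|²/(4t₀)}`. -/
def Ffunc (Γ : Conn n m) (x₀ : Fin n → ℝ) (t₀ : ℝ) : ℝ :=
  t₀ ^ 2 * (4 * π * t₀) ^ (-(n : ℝ) / 2) *
    ∫ x : Fin n → ℝ,
      normSqF Γ x * Real.exp (-(∑ i, (x i - x₀ i) ^ 2) / (4 * t₀))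

/-- The entropy `λ(Γ) = sup_{x₀, t₀>0} ℱ_{x₀,t₀}(Γ)`, valued in `[0,∞]`. -/
def entropy (Γ : Conn n m) : ℝ≥0∞ :=
  ⨆ (x₀ : Fin n → ℝ) (t₀ : ℝ) (_ : 0 < t₀), ENNReal.ofReal (Ffunc Γ x₀ t₀)

/-- Polynomial curvature growth: `|F(x)| ≤ p(|x|)`. -/
def PolyCurvGrowth (Γ : Conn n m) : Prop :=
  ∃ p : Polynomial ℝ, ∀ x, normF Γ x ≤ p.eval (enorm x)

/-- Polynomial curvature growth to order two. -/
def PolyCurvGrowth2 (Γ : Conn n m) : Prop :=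
  ∃ p : Polynomial ℝ, ∀ x,
    normF Γ x
      + (∑ i, ∑ j, ∑ k, frobNorm (covDer Γ i (fun y => curv Γ j k y) x))
      + (∑ i, ∑ j, ∑ k, ∑ l,
          frobNorm (covDer Γ i
            (fun y => covDer Γ j (fun z => curv Γ k l z) y) x))
      ≤ p.eval (enorm x)

/-- Cylindrical: some nonzero constant vector `V` satisfies `V ⌟ F ≡ 0`. -/
def Cylindrical (Γ : Conn n m) : Prop :=
  ∃ V : Fin n → ℝ, V ≠ 0 ∧
    ∀ (x : Fin n → ℝ) (k : Fin n), ∑ i, V i • curv Γ i k x = 0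

/-- `(DB)_{ij} = ∇ᵢBⱼ − ∇ⱼBᵢ`. -/
def Dop (Γ B : Conn n m) (i j : Fin n) (x : Fin n → ℝ) :
    Matrix (Fin m) (Fin m) ℝ :=
  covDer Γ i (fun y => B y j) x - covDer Γ j (fun y => B y i) x

/-- The second variation operator
`(L_{x₀,t₀}B)ₖ = −Σᵢ∇ᵢ(DB)_{ik} + (1/(2t₀))Σᵢ(x−x₀)ᵢ(DB)_{ik} + Σᵢ[Bᵢ,F_{ik}]`. -/
def Lop (Γ B : Conn n m) (x₀ : Fin n → ℝ) (t₀ : ℝ) (k : Fin n)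
    (x : Fin n → ℝ) : Matrix (Fin m) (Fin m) ℝ :=
  (- ∑ i, covDer Γ i (fun y => Dop Γ B i k y) x)
    + (1 / (2 * t₀)) • ∑ i, (x i - x₀ i) • Dop Γ B i k x
    + ∑ i, comm (B x i) (curv Γ i k x)

/-- The Gaussian weight `G(x) = (4π)^{−n/2} e^{−|x|²/4}`. -/
def gaussG (n : ℕ) (x : Fin n → ℝ) : ℝ :=
  (4 * π) ^ (-(n : ℝ) / 2) * Real.exp (-(∑ i, x i ^ 2) / 4)

/-- The second variation form `Q(σ,V,B)` of a `(0,1)`-soliton. -/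
def Q (Γ : Conn n m) (σ : ℝ) (V : Fin n → ℝ) (B : Conn n m) : ℝ :=
  -4 * σ ^ 2 * (∫ x : Fin n → ℝ, (∑ k, frobSq (dstarF Γ k x)) * gaussG n x)
    - 2 * (∫ x : Fin n → ℝ,
        (∑ k, frobSq (∑ i, V i • curv Γ i k x)) * gaussG n x)
    + 4 * (∫ x : Fin n → ℝ,
        (∑ k, frobInner (B x k) (Lop Γ B 0 1 k x)) * gaussG n x)
    - 4 * (∫ x : Fin n → ℝ,
        (∑ k, frobInner (B x k)
          (∑ i, (σ * x i + V i) • curv Γ i k x)) * gaussG n x)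

/-- Skew-symmetric-matrix-valued 1-form. -/
def SkewVals (B : Conn n m) : Prop := ∀ x i, (B x i)ᵀ = -(B x i)

/-- `ℱ`-instability. -/
def FUnstable (Γ : Conn n m) : Prop :=
  ∃ B : Conn n m, Smooth B ∧ HasCompactSupport B ∧ SkewVals B ∧
    ∀ (σ : ℝ) (V : Fin n → ℝ), Q Γ σ V B < 0

/-- Joint smoothness (entrywise) of a one-parameter family of connections on a
time set `S`. -/
def SmoothFamilyOn (Γt : ℝ → Conn n m) (S : Set ℝ) : Prop :=
  ∀ (k : Fin n) (a b : Fin m),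
    ContDiffOn ℝ (⊤ : ℕ∞) (fun p : ℝ × (Fin n → ℝ) => Γt p.1 p.2 k a b)
      (S ×ˢ (Set.univ : Set (Fin n → ℝ)))

/-- Yang–Mills flow: `∂ₜ(Γ_t)ₖ = Σᵢ ∇ᵢ(F_t)_{ik}` on a time set `S`. -/
def YMFlowOn (Γt : ℝ → Conn n m) (S : Set ℝ) : Prop :=
  ∀ t ∈ S, ∀ (x : Fin n → ℝ) (k : Fin n) (a b : Fin m),
    HasDerivWithinAt (fun t' => Γt t' x k a b)
      ((∑ i, covDer (Γt t) i (fun y => curv (Γt t) i k y) x) a b) S t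

/-- Locally uniform in time polynomial curvature growth to order two. -/
def PolyCurvGrowth2On (Γt : ℝ → Conn n m) (S : Set ℝ) : Prop :=
  ∀ J : Set ℝ, IsCompact J → J ⊆ S →
    ∃ p : Polynomial ℝ, ∀ t ∈ J, ∀ x,
      normF (Γt t) x
        + (∑ i, ∑ j, ∑ k,
            frobNorm (covDer (Γt t) i (fun y => curv (Γt t) j k y) x))
        + (∑ i, ∑ j, ∑ k, ∑ l,
            frobNorm (covDer (Γt t) i
              (fun y => covDer (Γt t) j (fun z => curv (Γt t) k l z) y) x))
        ≤ p.eval (enorm x)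

end YM

namespace FV
variable {n : ℕ}

def SubG (f : (Fin n → ℝ) → ℝ) : Prop :=
  ∀ δ : ℝ, 0 < δ → ∃ C : ℝ, 0 ≤ C ∧ ∀ x, |f x| ≤ C * Real.exp (δ * ∑ i, x i ^ 2)

lemma gauss_integrable {c : ℝ} (hc : 0 < c) :
    Integrable (fun x : Fin n → ℝ => Real.exp (-c * ∑ i, x i ^ 2)) := by
  have := Integrable.fintype_prod (ι := Fin n) (𝕜 := ℝ) (f := fun _ (y : ℝ) => Real.exp (-c * y ^ 2))
    (μ := fun _ => (volume : Measure ℝ)) (fun _ => integrable_exp_neg_mul_sq hc)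
  refine this.congr (Eventually.of_forall fun x => ?_)
  simp only [Finset.mul_sum, Real.exp_sum]

lemma SubG.of_bdd {f : (Fin n → ℝ) → ℝ} {K : ℝ} (h : ∀ x, |f x| ≤ K) : SubG f := by
  intro δ hδ
  refine ⟨|K|, abs_nonneg _, fun x => ?_⟩
  have h1 : 1 ≤ Real.exp (δ * ∑ i, x i ^ 2) :=
    Real.one_le_exp (mul_nonneg hδ.le (Finset.sum_nonneg fun i _ => sq_nonneg _))
  calc |f x| ≤ |K| * 1 := by rw [mul_one]; exact (h x).trans (le_abs_self _)
    _ ≤ _ := by gcongr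

lemma SubG.const (K : ℝ) : SubG (fun _ : Fin n → ℝ => K) := SubG.of_bdd (K := |K|) fun _ => le_rfl

lemma SubG.mono {f g : (Fin n → ℝ) → ℝ} (hg : SubG g) (h : ∀ x, |f x| ≤ |g x|) : SubG f := by
  intro δ hδ
  obtain ⟨C, hC, hb⟩ := hg δ hδ
  exact ⟨C, hC, fun x => (h x).trans (hb x)⟩

lemma SubG.add {f g : (Fin n → ℝ) → ℝ} (hf : SubG f) (hg : SubG g) :
    SubG (fun x => f x + g x) := by
  intro δ hδ
  obtain ⟨C, hC, hb⟩ := hf δ hδ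
  obtain ⟨D, hD, hb'⟩ := hg δ hδ
  refine ⟨C + D, by positivity, fun x => ?_⟩
  rw [add_mul]
  exact (abs_add_le _ _).trans (add_le_add (hb x) (hb' x))

lemma SubG.mul {f g : (Fin n → ℝ) → ℝ} (hf : SubG f) (hg : SubG g) :
    SubG (fun x => f x * g x) := by
  intro δ hδ
  obtain ⟨C, hC, hb⟩ := hf (δ/2) (by positivity)
  obtain ⟨D, hD, hb'⟩ := hg (δ/2) (by positivity)
  refine ⟨C * D, by positivity, fun x => ?_⟩
  rw [abs_mul]
  calc |f x| * |g x| ≤ (C * Real.exp (δ/2 * ∑ i, x i ^ 2)) * (D * Real.exp (δ/2 * ∑ i, x i ^ 2)) :=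
        mul_le_mul (hb x) (hb' x) (abs_nonneg _) (by positivity)
    _ = C * D * (Real.exp (δ/2 * ∑ i, x i ^ 2) * Real.exp (δ/2 * ∑ i, x i ^ 2)) := by ring
    _ = _ := by rw [← Real.exp_add]; ring_nf

lemma SubG.abs {f : (Fin n → ℝ) → ℝ} (hf : SubG f) : SubG (fun x => |f x|) :=
  hf.mono fun x => by simp

lemma SubG.r2 : SubG (fun x : Fin n → ℝ => ∑ i, x i ^ 2) := by
  intro δ hδ
  refine ⟨1/δ, by positivity, fun x => ?_⟩
  have h0 : 0 ≤ ∑ i, x i ^ 2 := Finset.sum_nonneg fun i _ => sq_nonneg _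
  rw [abs_of_nonneg h0]
  have := Real.add_one_le_exp (δ * ∑ i, x i ^ 2)
  calc ∑ i, x i ^ 2 = 1/δ * (δ * ∑ i, x i ^ 2) := by field_simp
    _ ≤ _ := by gcongr; linarith

lemma SubG.r : SubG (fun x : Fin n → ℝ => √(∑ i, x i ^ 2)) := by
  refine ((SubG.const 1).add SubG.r2).mono fun x => ?_
  have h0 : 0 ≤ ∑ i, x i ^ 2 := Finset.sum_nonneg fun i _ => sq_nonneg _
  rw [abs_of_nonneg (Real.sqrt_nonneg _), abs_of_nonneg (by positivity)]
  nlinarith [Real.sq_sqrt h0, sq_nonneg (√(∑ i, x i ^ 2) - 1)]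

lemma SubG.pow {f : (Fin n → ℝ) → ℝ} (hf : SubG f) (k : ℕ) : SubG (fun x => f x ^ k) := by
  induction k with
  | zero => simpa using SubG.const 1
  | succ k ih => simpa [pow_succ] using ih.mul hf

lemma SubG.poly (p : Polynomial ℝ) : SubG (fun x : Fin n → ℝ => p.eval √(∑ i, x i ^ 2)) := by
  induction p using Polynomial.induction_on' with
  | add p q hp hq => simpa using hp.add hq
  | monomial k a => simpa using (SubG.const a).mul (SubG.r.pow k)

lemma SubG.fun_sum {ι : Type*} (s : Finset ι) {f : ι → (Fin n → ℝ) → ℝ} (h : ∀ i, SubG (f i)) :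
    SubG (fun x => ∑ i ∈ s, f i x) := by
  classical
  induction s using Finset.induction_on with
  | empty => simpa using SubG.const 0
  | insert a s ha ih => simpa [Finset.sum_insert ha] using (h a).add ih

lemma SubG.coord (i : Fin n) : SubG (fun x : Fin n → ℝ => x i) := by
  refine SubG.r.mono fun x => ?_
  rw [abs_of_nonneg (Real.sqrt_nonneg _)]
  exact Real.abs_le_sqrt (Finset.single_le_sum (f := fun i => x i ^ 2)
    (fun i _ => sq_nonneg _) (Finset.mem_univ i))

lemma SubG.lin (v w : Fin n → ℝ) : SubG (fun x : Fin n → ℝ => ∑ i, v i * (x i - w i)) :=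
  SubG.fun_sum _ fun i => (SubG.const (v i)).mul
    (by simpa [sub_eq_add_neg] using (SubG.coord i).add (SubG.const (-w i)))

lemma SubG.quad (w : Fin n → ℝ) : SubG (fun x : Fin n → ℝ => ∑ i, (x i - w i) ^ 2) :=
  SubG.fun_sum _ fun i => SubG.pow
    (by simpa [sub_eq_add_neg] using (SubG.coord i).add (SubG.const (-w i))) 2

lemma exp_bound {t T W : ℝ} (ht : 0 < t) (htT : t ≤ T) (w : Fin n → ℝ) (hw : ∑ i, w i ^ 2 ≤ W)
    (x : Fin n → ℝ) :
    Real.exp (-(∑ i, (x i - w i) ^ 2) / (4 * t)) ≤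
      Real.exp (W / (4 * T)) * Real.exp (-(1 / (8 * T)) * ∑ i, x i ^ 2) := by
  rw [← Real.exp_add]
  apply Real.exp_le_exp.2
  have hT : 0 < T := ht.trans_le htT
  have h1 : (∑ i, x i ^ 2) / 2 - W ≤ ∑ i, (x i - w i) ^ 2 := by
    have : ∑ i, (x i ^ 2 / 2 - w i ^ 2) ≤ ∑ i, (x i - w i) ^ 2 :=
      Finset.sum_le_sum fun i _ => by nlinarith [sq_nonneg (x i - 2 * w i)]
    rw [Finset.sum_sub_distrib, ← Finset.sum_div] at this
    linarith
  have h0 : 0 ≤ ∑ i, (x i - w i) ^ 2 := Finset.sum_nonneg fun i _ => sq_nonneg _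
  have h2 : (∑ i, (x i - w i) ^ 2) / (4 * T) ≤ (∑ i, (x i - w i) ^ 2) / (4 * t) := by gcongr
  have h3 : ((∑ i, x i ^ 2) / 2 - W) / (4 * T) ≤ (∑ i, (x i - w i) ^ 2) / (4 * T) := by gcongr
  have h4 : ((∑ i, x i ^ 2) / 2 - W) / (4 * T) = -(W / (4 * T) + -(1 / (8 * T)) * ∑ i, x i ^ 2) := by
    field_simp; ring
  rw [neg_div]
  linarith

lemma SubG.integrable_bound {f : (Fin n → ℝ) → ℝ} (hf : SubG f) {c : ℝ} (hc : 0 < c)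
    (hm : Continuous f) : Integrable (fun x => f x * Real.exp (-c * ∑ i, x i ^ 2)) := by
  obtain ⟨C, hC, hb⟩ := hf (c/2) (by positivity)
  refine ((gauss_integrable (n := n) (half_pos hc)).const_mul C).mono'
    (by apply Continuous.aestronglyMeasurable; fun_prop) (Eventually.of_forall fun x => ?_)
  rw [norm_mul, Real.norm_eq_abs, Real.norm_eq_abs, Real.abs_exp]
  calc |f x| * Real.exp (-c * ∑ i, x i ^ 2) ≤
      C * Real.exp (c/2 * ∑ i, x i ^ 2) * Real.exp (-c * ∑ i, x i ^ 2) := by gcongr; exact hb x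
    _ = _ := by rw [mul_assoc, ← Real.exp_add]; ring_nf

lemma SubG.integrable {f : (Fin n → ℝ) → ℝ} (hf : SubG f) (hm : Continuous f) {t : ℝ} (ht : 0 < t)
    (w : Fin n → ℝ) :
    Integrable (fun x => f x * Real.exp (-(∑ i, (x i - w i) ^ 2) / (4 * t))) := by
  refine ((hf.integrable_bound (c := 1 / (8*t)) (by positivity) hm).abs.const_mul
    (Real.exp ((∑ i, w i ^ 2) / (4 * t)))).mono'
    (by apply Continuous.aestronglyMeasurable; fun_prop) (Eventually.of_forall fun x => ?_)
  rw [norm_mul, Real.norm_eq_abs, Real.norm_eq_abs, Real.abs_exp, abs_mul, Real.abs_exp]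
  have := exp_bound ht le_rfl w le_rfl x
  calc _ ≤ |f x| * _ := mul_le_mul_of_nonneg_left this (abs_nonneg _)
    _ = _ := by ring

lemma deriv_integral {N0 c1 c2 c3 c4 : (Fin n → ℝ) → ℝ}
    (h0 : SubG N0) (h1 : SubG c1) (h2 : SubG c2) (h3 : SubG c3) (h4 : SubG c4)
    (k0 : Continuous N0) (k1 : Continuous c1) (k2 : Continuous c2) (k3 : Continuous c3)
    (k4 : Continuous c4) (x₀ v : Fin n → ℝ) (t₀ τ : ℝ) (ht : 0 < t₀) :
    HasDerivAt (fun s : ℝ => ∫ x, (N0 x + s * c1 x + s^2 * c2 x + s^3 * c3 x + s^4 * c4 x) *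
        Real.exp (-(∑ i, (x i - (x₀ + s • v) i) ^ 2) / (4 * (t₀ + s * τ))))
      (∫ x, (c1 x + N0 x * ((∑ i, v i * (x i - x₀ i)) / (2 * t₀) +
        (∑ i, (x i - x₀ i) ^ 2) * τ / (4 * t₀ ^ 2))) *
        Real.exp (-(∑ i, (x i - x₀ i) ^ 2) / (4 * t₀))) 0 := by
  set W : ℝ := ∑ i, (2 * x₀ i ^ 2 + 2 * v i ^ 2) with hW
  set V : ℝ := ∑ i, v i ^ 2 with hV
  have hV0 : 0 ≤ V := Finset.sum_nonneg fun i _ => sq_nonneg _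
  have hW0 : 0 ≤ W := Finset.sum_nonneg fun i _ => by positivity
  set ε : ℝ := min 1 (t₀ / (2 * (|τ| + 1))) with hε
  have hε0 : 0 < ε := by positivity
  set q' : ℝ → (Fin n → ℝ) → ℝ := fun s x =>
    (∑ i, v i * (x i - (x₀ + s • v) i)) / (2 * (t₀ + s * τ)) +
      (∑ i, (x i - (x₀ + s • v) i) ^ 2) * τ / (4 * (t₀ + s * τ) ^ 2) with hq'
  set F' : ℝ → (Fin n → ℝ) → ℝ := fun s x =>
    ((c1 x + 2 * s * c2 x + 3 * s^2 * c3 x + 4 * s^3 * c4 x) +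
      (N0 x + s * c1 x + s^2 * c2 x + s^3 * c3 x + s^4 * c4 x) * q' s x) *
      Real.exp (-(∑ i, (x i - (x₀ + s • v) i) ^ 2) / (4 * (t₀ + s * τ))) with hF'
  set Qb : (Fin n → ℝ) → ℝ := fun x =>
    (2 * (∑ i, x i ^ 2) + 2 * W + V) / (2 * t₀) + (2 * (∑ i, x i ^ 2) + 2 * W) * |τ| / t₀ ^ 2 with hQb
  set Hb : (Fin n → ℝ) → ℝ := fun x =>
    (|N0 x| + |c1 x| + |c2 x| + |c3 x| + |c4 x|) * (4 + Qb x) with hHb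
  have hs : ∀ s ∈ Metric.ball (0:ℝ) ε, |s| ≤ 1 ∧ t₀ / 2 ≤ t₀ + s * τ ∧ t₀ + s * τ ≤ 2 * t₀ := by
    intro s hs
    rw [Metric.mem_ball, dist_zero_right, Real.norm_eq_abs] at hs
    have a1 : |s| < 1 := hs.trans_le (min_le_left _ _)
    have a2 : |s| < t₀ / (2 * (|τ| + 1)) := hs.trans_le (min_le_right _ _)
    have a3 : |s * τ| ≤ t₀ / 2 := by
      rw [abs_mul]
      rw [lt_div_iff₀ (by positivity)] at a2
      nlinarith [abs_nonneg s]
    have := abs_le.1 a3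
    exact ⟨a1.le, by linarith [this.1], by linarith [this.2]⟩
  have hw : ∀ s : ℝ, |s| ≤ 1 → ∑ i, (x₀ + s • v) i ^ 2 ≤ W := by
    intro s hs
    refine Finset.sum_le_sum fun i _ => ?_
    simp only [Pi.add_apply, Pi.smul_apply, smul_eq_mul]
    have : s ^ 2 ≤ 1 := by rwa [sq_le_one_iff_abs_le_one]
    nlinarith [sq_nonneg (x₀ i - s * v i), sq_nonneg (v i)]
  have hqb : ∀ s ∈ Metric.ball (0:ℝ) ε, ∀ x, |q' s x| ≤ Qb x := by
    intro s hsb x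
    obtain ⟨b1, b2, b3⟩ := hs s hsb
    have b0 : 0 < t₀ + s * τ := by linarith
    set S := ∑ i, (x i - (x₀ + s • v) i) ^ 2 with hS
    have hS0 : 0 ≤ S := Finset.sum_nonneg fun i _ => sq_nonneg _
    have hSW : S ≤ 2 * (∑ i, x i ^ 2) + 2 * W := by
      have : S ≤ ∑ i, (2 * x i ^ 2 + 2 * (x₀ + s • v) i ^ 2) :=
        Finset.sum_le_sum fun i _ => by nlinarith [sq_nonneg (x i + (x₀ + s • v) i)]
      rw [Finset.sum_add_distrib, ← Finset.mul_sum, ← Finset.mul_sum] at this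
      linarith [hw s b1]
    have hl : |∑ i, v i * (x i - (x₀ + s • v) i)| ≤ (S + V) / 2 := by
      have : |∑ i, v i * (x i - (x₀ + s • v) i)| ≤ ∑ i, ((x i - (x₀ + s • v) i) ^ 2 + v i ^ 2) / 2 := by
        refine (Finset.abs_sum_le_sum_abs _ _).trans (Finset.sum_le_sum fun i _ => ?_)
        rw [abs_le]
        constructor <;> nlinarith [sq_nonneg (v i - (x i - (x₀ + s • v) i)), sq_nonneg (v i + (x i - (x₀ + s • v) i))]
      rwa [← Finset.sum_div, Finset.sum_add_distrib] at this
    refine (abs_add_le _ _).trans (add_le_add ?_ ?_)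
    · rw [abs_div, abs_of_pos (show 0 < 2 * (t₀ + s * τ) by positivity),
        div_le_div_iff₀ (by positivity) (by positivity)]
      have : |∑ i, v i * (x i - (x₀ + s • v) i)| ≤ (2 * (∑ i, x i ^ 2) + 2 * W + V) / 2 := by linarith
      nlinarith [abs_nonneg (∑ i, v i * (x i - (x₀ + s • v) i))]
    · rw [abs_div, abs_mul, abs_of_nonneg hS0, abs_of_pos (show 0 < 4 * (t₀ + s * τ)^2 by positivity)]
      have e1 : t₀ ^ 2 ≤ 4 * (t₀ + s * τ)^2 := by nlinarith
      gcongr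
  have hHs : SubG Hb := by
    refine ((((h0.abs.add h1.abs).add h2.abs).add h3.abs).add h4.abs).mul ((SubG.const 4).add ?_)
    have e := (((SubG.const (n := n) 2).mul SubG.r2).add (SubG.const (2 * W)))
    have e1 := (e.add (SubG.const V)).mul (SubG.const (1 / (2 * t₀)))
    have e2 := (e.mul (SubG.const |τ|)).mul (SubG.const (1 / t₀ ^ 2))
    refine (e1.add e2).mono fun x => le_of_eq ?_
    congr 1; ring
  have hHc : Continuous Hb := by simp only [hHb, hQb]; fun_prop
  have key := hasDerivAt_integral_of_dominated_loc_of_deriv_le (μ := (volume : Measure (Fin n → ℝ)))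
    (F := fun s x => (N0 x + s * c1 x + s^2 * c2 x + s^3 * c3 x + s^4 * c4 x) *
        Real.exp (-(∑ i, (x i - (x₀ + s • v) i) ^ 2) / (4 * (t₀ + s * τ))))
    (F' := F') (x₀ := (0:ℝ)) (s := Metric.ball 0 ε)
    (bound := fun x => Real.exp (W / (4 * (2 * t₀))) *
      (Hb x * Real.exp (-(1 / (8 * (2 * t₀))) * ∑ i, x i ^ 2)))
    (Metric.ball_mem_nhds _ hε0) ?_ ?_ ?_ ?_ ?_ ?_
  · refine key.2.congr_deriv (integral_congr_ae (Eventually.of_forall fun x => ?_))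
    simp [F', q']
  · refine Eventually.of_forall fun s => Continuous.aestronglyMeasurable ?_
    fun_prop
  · have := h0.integrable k0 ht x₀
    simpa using this
  · apply Continuous.aestronglyMeasurable
    simp only [hF', hq']
    fun_prop
  · refine Eventually.of_forall fun x s hsb => ?_
    obtain ⟨b1, b2, b3⟩ := hs s hsb
    have b0 : 0 < t₀ + s * τ := by linarith
    have e1 := exp_bound b0 b3 _ (hw s b1) x
    have e2 : |(c1 x + 2 * s * c2 x + 3 * s^2 * c3 x + 4 * s^3 * c4 x) +
      (N0 x + s * c1 x + s^2 * c2 x + s^3 * c3 x + s^4 * c4 x) * q' s x| ≤ Hb x := by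
      have p (k : ℕ) : |s ^ k| ≤ 1 := by rw [abs_pow]; exact pow_le_one₀ (abs_nonneg _) b1
      have m (k : ℕ) (c : ℝ) : |s ^ k * c| ≤ |c| := by
        rw [abs_mul]; exact mul_le_of_le_one_left (abs_nonneg _) (p k)
      have hN : |N0 x + s * c1 x + s^2 * c2 x + s^3 * c3 x + s^4 * c4 x| ≤
          |N0 x| + |c1 x| + |c2 x| + |c3 x| + |c4 x| := by
        have m1 := m 1 (c1 x)
        rw [pow_one] at m1
        refine (abs_add_le _ _).trans (add_le_add ?_ (m 4 _))
        refine (abs_add_le _ _).trans (add_le_add ?_ (m 3 _))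
        refine (abs_add_le _ _).trans (add_le_add ?_ (m 2 _))
        exact (abs_add_le _ _).trans (add_le_add le_rfl m1)
      have hD : |c1 x + 2 * s * c2 x + 3 * s^2 * c3 x + 4 * s^3 * c4 x| ≤
          (|N0 x| + |c1 x| + |c2 x| + |c3 x| + |c4 x|) * 4 := by
        have m1 := abs_le.1 (m 1 (c2 x))
        rw [pow_one] at m1
        have m2 := abs_le.1 (m 2 (c3 x))
        have m3 := abs_le.1 (m 3 (c4 x))
        have m0 := abs_le.1 (le_refl |c1 x|)
        rw [abs_le]
        constructor <;> linarith [m0.1, m0.2, m1.1, m1.2, m2.1, m2.2, m3.1, m3.2, abs_nonneg (N0 x),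
          abs_nonneg (c1 x), abs_nonneg (c2 x), abs_nonneg (c3 x), abs_nonneg (c4 x)]
      simp only [hHb]
      rw [mul_add _ 4 (Qb x)]
      refine (abs_add_le _ _).trans (add_le_add hD ?_)
      rw [abs_mul]
      exact mul_le_mul hN (hqb s hsb x) (abs_nonneg _) (by positivity)
    simp only [hF']
    rw [norm_mul, Real.norm_eq_abs, Real.norm_eq_abs, Real.abs_exp]
    calc _ ≤ Hb x * _ := mul_le_mul e2 e1 (Real.exp_pos _).le ((abs_nonneg _).trans e2)
      _ = _ := by ring
  · exact (hHs.integrable_bound (by positivity) hHc).const_mul _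
  · refine Eventually.of_forall fun x s hsb => ?_
    obtain ⟨b1, b2, b3⟩ := hs s hsb
    have b0 : t₀ + s * τ ≠ 0 := by linarith
    have d1 : HasDerivAt (fun s : ℝ => ∑ i, (x i - (x₀ + s • v) i) ^ 2)
        (-2 * ∑ i, v i * (x i - (x₀ + s • v) i)) s := by
      rw [Finset.mul_sum]
      refine HasDerivAt.fun_sum fun i _ => ?_
      simp only [Pi.add_apply, Pi.smul_apply, smul_eq_mul]
      have := ((((hasDerivAt_id s).mul_const (v i)).const_add (x₀ i)).const_sub (x i)).pow 2
      refine this.congr_deriv ?_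
      simp; ring
    have d2 : HasDerivAt (fun s : ℝ => 4 * (t₀ + s * τ)) (4 * τ) s := by
      have := (((hasDerivAt_id s).mul_const τ).const_add t₀).const_mul 4
      refine this.congr_deriv ?_
      simp
    have d3 := (d1.neg.div d2 (by positivity)).exp
    have d4 : HasDerivAt (fun s : ℝ => N0 x + s * c1 x + s^2 * c2 x + s^3 * c3 x + s^4 * c4 x)
        (c1 x + 2 * s * c2 x + 3 * s^2 * c3 x + 4 * s^3 * c4 x) s := by
      have := (((((hasDerivAt_id s).mul_const (c1 x)).const_add (N0 x)).add
        (((hasDerivAt_id s).pow 2).mul_const (c2 x))).add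
        (((hasDerivAt_id s).pow 3).mul_const (c3 x))).add
        (((hasDerivAt_id s).pow 4).mul_const (c4 x))
      refine this.congr_deriv ?_
      simp
    refine (d4.mul d3).congr_deriv ?_
    simp only [hF', hq', Pi.neg_apply, Pi.div_apply]
    field_simp
    ring
end FV
namespace FV
open YM
variable {n m : ℕ}

lemma smooth_pder {A : (Fin n → ℝ) → Matrix (Fin m) (Fin m) ℝ} (hA : SmoothMat A) (i : Fin n) :
    SmoothMat (fun x => pder i A x) := by
  intro a b
  have h := (hA a b).fderiv_right (m := ((⊤ : ℕ∞) : WithTop ℕ∞)) (by simp)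
  exact h.clm_apply contDiff_const

lemma smooth_add {A C : (Fin n → ℝ) → Matrix (Fin m) (Fin m) ℝ} (hA : SmoothMat A)
    (hC : SmoothMat C) : SmoothMat (fun x => A x + C x) := fun a b => (hA a b).add (hC a b)

lemma smooth_sub {A C : (Fin n → ℝ) → Matrix (Fin m) (Fin m) ℝ} (hA : SmoothMat A)
    (hC : SmoothMat C) : SmoothMat (fun x => A x - C x) := fun a b => (hA a b).sub (hC a b)

lemma smooth_mul {A C : (Fin n → ℝ) → Matrix (Fin m) (Fin m) ℝ} (hA : SmoothMat A)
    (hC : SmoothMat C) : SmoothMat (fun x => A x * C x) := by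
  intro a b
  simp only [Matrix.mul_apply]
  exact ContDiff.sum fun c _ => (hA a c).mul (hC c b)

lemma smooth_comm {A C : (Fin n → ℝ) → Matrix (Fin m) (Fin m) ℝ} (hA : SmoothMat A)
    (hC : SmoothMat C) : SmoothMat (fun x => comm (A x) (C x)) :=
  smooth_sub (smooth_mul hA hC) (smooth_mul hC hA)

lemma smooth_curv {Γ : Conn n m} (h : Smooth Γ) (i j : Fin n) : SmoothMat (fun x => curv Γ i j x) :=
  smooth_add (smooth_sub (smooth_pder (h j) i) (smooth_pder (h i) j)) (smooth_comm (h i) (h j))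

lemma smooth_covDer {Γ : Conn n m} (h : Smooth Γ) (i : Fin n)
    {A : (Fin n → ℝ) → Matrix (Fin m) (Fin m) ℝ} (hA : SmoothMat A) :
    SmoothMat (fun x => covDer Γ i A x) :=
  smooth_add (smooth_pder hA i) (smooth_comm (h i) hA)

lemma smooth_Dop {Γ B : Conn n m} (h : Smooth Γ) (hB : Smooth B) (i j : Fin n) :
    SmoothMat (fun x => Dop Γ B i j x) :=
  smooth_sub (smooth_covDer h i (hB j)) (smooth_covDer h j (hB i))

lemma contDiff_frobInner {A C : (Fin n → ℝ) → Matrix (Fin m) (Fin m) ℝ} (hA : SmoothMat A)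
    (hC : SmoothMat C) : ContDiff ℝ (⊤ : ℕ∞) (fun x => frobInner (A x) (C x)) :=
  ContDiff.sum fun a _ => ContDiff.sum fun b _ => (hA a b).mul (hC a b)

lemma frobSq_eq (A : Matrix (Fin m) (Fin m) ℝ) : frobSq A = frobInner A A := by
  simp only [frobSq, frobInner, sq]

lemma fi_comm (A C : Matrix (Fin m) (Fin m) ℝ) : frobInner A C = frobInner C A := by
  simp only [frobInner, mul_comm]

lemma fi_add (A C D : Matrix (Fin m) (Fin m) ℝ) :
    frobInner A (C + D) = frobInner A C + frobInner A D := by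
  simp only [frobInner, Matrix.add_apply, mul_add, Finset.sum_add_distrib]

lemma fi_smul (A C : Matrix (Fin m) (Fin m) ℝ) (r : ℝ) :
    frobInner A (r • C) = r * frobInner A C := by
  simp only [frobInner, Matrix.smul_apply, smul_eq_mul, Finset.mul_sum]
  exact Finset.sum_congr rfl fun a _ => Finset.sum_congr rfl fun b _ => by ring

lemma fi_neg (A C : Matrix (Fin m) (Fin m) ℝ) : frobInner A (-C) = - frobInner A C := by
  simp [frobInner]

lemma fi_sub (A C D : Matrix (Fin m) (Fin m) ℝ) :
    frobInner A (C - D) = frobInner A C - frobInner A D := by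
  rw [sub_eq_add_neg, fi_add, fi_neg, sub_eq_add_neg]

lemma fi_zero (A : Matrix (Fin m) (Fin m) ℝ) : frobInner A 0 = 0 := by
  simp [frobInner]

lemma fi_zero' (A : Matrix (Fin m) (Fin m) ℝ) : frobInner 0 A = 0 := by
  simp [frobInner]

lemma fi_sum {ι : Type*} (s : Finset ι) (A : Matrix (Fin m) (Fin m) ℝ)
    (C : ι → Matrix (Fin m) (Fin m) ℝ) :
    frobInner A (∑ i ∈ s, C i) = ∑ i ∈ s, frobInner A (C i) := by
  classical
  induction s using Finset.induction_on with
  | empty => simp [fi_zero]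
  | insert a s ha ih => rw [Finset.sum_insert ha, Finset.sum_insert ha, fi_add, ih]

lemma fi_trace (A C : Matrix (Fin m) (Fin m) ℝ) : frobInner A C = (A * Cᵀ).trace := by
  simp [frobInner, Matrix.trace, Matrix.mul_apply]

lemma fi_skew {G : Matrix (Fin m) (Fin m) ℝ} (hG : Gᵀ = -G) (A C : Matrix (Fin m) (Fin m) ℝ) :
    frobInner A (comm G C) = - frobInner C (comm G A) := by
  rw [fi_comm C]
  simp only [fi_trace, YM.comm, Matrix.transpose_sub, Matrix.transpose_mul, hG, mul_sub, sub_mul,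
    Matrix.trace_sub, mul_neg, neg_mul, Matrix.trace_neg]
  rw [Matrix.mul_assoc G A, Matrix.trace_mul_comm G (A * Cᵀ)]
  simp only [Matrix.mul_assoc]
  ring

lemma frobSq_expand (A D C : Matrix (Fin m) (Fin m) ℝ) (s : ℝ) :
    frobSq (A + s • D + s ^ 2 • C) = frobSq A + s * (2 * frobInner A D)
      + s ^ 2 * (frobSq D + 2 * frobInner A C) + s ^ 3 * (2 * frobInner D C) + s ^ 4 * frobSq C := by
  simp only [frobSq_eq, fi_add, fi_smul]
  rw [fi_comm _ A, fi_comm _ D, fi_comm _ C]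
  simp only [fi_add, fi_smul]
  rw [fi_comm D A, fi_comm C A, fi_comm C D]
  ring

lemma pder_add_smul {A C : (Fin n → ℝ) → Matrix (Fin m) (Fin m) ℝ} (hA : SmoothMat A)
    (hC : SmoothMat C) (s : ℝ) (i : Fin n) (x : Fin n → ℝ) :
    pder i (fun y => A y + s • C y) x = pder i A x + s • pder i C x := by
  ext a b
  have h1 : DifferentiableAt ℝ (fun y => A y a b) x := (hA a b).differentiable (by simp) x
  have h2 : DifferentiableAt ℝ (fun y => C y a b) x := (hC a b).differentiable (by simp) x
  have := (h1.hasFDerivAt.add (h2.hasFDerivAt.const_mul s)).fderiv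
  have e : (fun y => (A y + s • C y) a b) = (fun y => A y a b) + fun y => s * C y a b := rfl
  simp only [pder, Matrix.of_apply, Matrix.add_apply, Matrix.smul_apply, smul_eq_mul]
  simp only [e] at *
  change fderiv ℝ ((fun y => A y a b) + fun y => s * C y a b) x _ = _
  rw [this]
  simp

lemma curv_expand {Γ B : Conn n m} (h : Smooth Γ) (hB : Smooth B) (s : ℝ) (i j : Fin n)
    (x : Fin n → ℝ) :
    curv (fun x i => Γ x i + s • B x i) i j x =
      curv Γ i j x + s • Dop Γ B i j x + s ^ 2 • comm (B x i) (B x j) := by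
  simp only [curv, Dop, covDer]
  rw [pder_add_smul (h j) (hB j), pder_add_smul (h i) (hB i)]
  simp only [YM.comm, add_mul, mul_add, smul_add, smul_sub, Matrix.smul_mul, Matrix.mul_smul, sq,
    mul_smul]
  abel

lemma curv_antisymm (Γ : Conn n m) (i j : Fin n) (x : Fin n → ℝ) :
    curv Γ j i x = - curv Γ i j x := by
  simp only [curv, YM.comm]; abel

lemma B_zero {B : Conn n m} {x : Fin n → ℝ} (hx : x ∉ tsupport B) (i : Fin n) : B x i = 0 := by
  rw [image_eq_zero_of_notMem_tsupport hx]; rfl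

lemma pderB_zero {B : Conn n m} {x : Fin n → ℝ} (hx : x ∉ tsupport B) (i j : Fin n) :
    pder i (fun y => B y j) x = 0 := by
  ext a b
  have hx' : x ∉ tsupport (fun y => B y j a b) := fun h => hx
    (closure_mono (fun y hy => by
      rw [Function.mem_support] at hy ⊢
      intro h0; apply hy; simp [h0]) h)
  simp only [pder, Matrix.of_apply]
  rw [fderiv_of_notMem_tsupport ℝ hx']
  rfl

lemma Dop_zero {Γ B : Conn n m} {x : Fin n → ℝ} (hx : x ∉ tsupport B) (i j : Fin n) :
    Dop Γ B i j x = 0 := by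
  simp [Dop, covDer, pderB_zero hx, B_zero hx, YM.comm]

lemma subG_of_supp {B : Conn n m} (hB : HasCompactSupport B) {f : (Fin n → ℝ) → ℝ}
    (hf : Continuous f) (h0 : ∀ x, x ∉ tsupport B → f x = 0) : SubG f := by
  have hc : HasCompactSupport f := HasCompactSupport.intro hB.isCompact h0
  obtain ⟨K, hK⟩ := hc.exists_bound_of_continuous hf
  exact SubG.of_bdd hK

/-- The divergence of a compactly supported vector field integrates to zero. -/
lemma integral_fderiv_zero {X : (Fin n → ℝ) → ℝ} (hX : ContDiff ℝ (⊤ : ℕ∞) X)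
    (hc : HasCompactSupport X) (v : Fin n → ℝ) :
    Integrable (fun x => fderiv ℝ X x v) ∧ ∫ x, fderiv ℝ X x v = 0 := by
  have hi : Integrable (fun x => fderiv ℝ X x v) :=
    ((hX.continuous_fderiv (by simp)).clm_apply continuous_const).integrable_of_hasCompactSupport
      (hc.fderiv_apply ℝ v)
  refine ⟨hi, ?_⟩
  have := integral_mul_fderiv_eq_neg_fderiv_mul_of_integrable (μ := (volume : Measure (Fin n → ℝ)))
    (f := fun _ : Fin n → ℝ => (1:ℝ)) (g := X) (v := v) (by simp) (by simpa using hi)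
    (by simpa using hX.continuous.integrable_of_hasCompactSupport hc)
    (fun x _ => differentiableAt_const _) (fun x _ => hX.differentiable (by simp) x)
  simpa using this

lemma hasFDerivAt_frobInner {A C : (Fin n → ℝ) → Matrix (Fin m) (Fin m) ℝ} (hA : SmoothMat A)
    (hC : SmoothMat C) (i : Fin n) (x : Fin n → ℝ) :
    fderiv ℝ (fun y => frobInner (A y) (C y)) x (Pi.single i 1) =
      frobInner (pder i A x) (C x) + frobInner (A x) (pder i C x) := by
  have h1 : ∀ a b, HasFDerivAt (fun y => A y a b) (fderiv ℝ (fun y => A y a b) x) x :=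
    fun a b => ((hA a b).differentiable (by simp) x).hasFDerivAt
  have h2 : ∀ a b, HasFDerivAt (fun y => C y a b) (fderiv ℝ (fun y => C y a b) x) x :=
    fun a b => ((hC a b).differentiable (by simp) x).hasFDerivAt
  have := HasFDerivAt.fun_sum (u := Finset.univ) fun a _ =>
    HasFDerivAt.fun_sum (u := Finset.univ) fun b _ => (h1 a b).mul (h2 a b)
  have e := HasFDerivAt.fderiv this
  simp only [frobInner]
  erw [e]
  simp only [pder, Matrix.of_apply, ← Finset.sum_add_distrib, _root_.sum_apply,
    _root_.add_apply, _root_.smul_apply, smul_eq_mul]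
  exact Finset.sum_congr rfl fun a _ => Finset.sum_congr rfl fun b _ => by ring

def gE (x₀ : Fin n → ℝ) (t₀ : ℝ) (x : Fin n → ℝ) : ℝ :=
  Real.exp (-(∑ i, (x i - x₀ i) ^ 2) / (4 * t₀))

lemma contDiff_gE (x₀ : Fin n → ℝ) (t₀ : ℝ) : ContDiff ℝ (⊤ : ℕ∞) (gE x₀ t₀) := by
  unfold gE
  fun_prop

lemma fderiv_gE (x₀ : Fin n → ℝ) {t₀ : ℝ} (ht : 0 < t₀) (i : Fin n) (x : Fin n → ℝ) :
    fderiv ℝ (gE x₀ t₀) x (Pi.single i 1) = -((x i - x₀ i) / (2 * t₀)) * gE x₀ t₀ x := by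
  have hd : HasFDerivAt (gE x₀ t₀) (fderiv ℝ (gE x₀ t₀) x) x :=
    ((contDiff_gE x₀ t₀).differentiable (by simp) x).hasFDerivAt
  have h1 : ∀ j, HasDerivAt (fun s : ℝ => ((x + s • (Pi.single i 1 : Fin n → ℝ)) j - x₀ j) ^ 2)
      (2 * (x j - x₀ j) * (Pi.single i 1 : Fin n → ℝ) j) 0 := by
    intro j
    have := ((((hasDerivAt_id (0:ℝ)).mul_const ((Pi.single i 1 : Fin n → ℝ) j)).const_add
      (x j)).sub_const (x₀ j)).pow 2
    refine this.congr_deriv ?_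
    simp
  have h2 := ((HasDerivAt.fun_sum (u := Finset.univ) fun j _ => h1 j).neg.div_const (4 * t₀)).exp
  have h3 : HasLineDerivAt ℝ (gE x₀ t₀) _ x (Pi.single i 1) := h2
  have h4 := (hd.hasLineDerivAt (Pi.single i 1)).unique h3
  rw [h4]
  have : ∑ j, 2 * (x j - x₀ j) * (Pi.single i 1 : Fin n → ℝ) j = 2 * (x i - x₀ i) := by
    simp [Pi.single_apply]
  rw [this]
  simp only [Pi.neg_apply, zero_smul, add_zero, gE]
  field_simp
  ring

lemma c1_eq {Γ : Conn n m} (B : Conn n m) (x : Fin n → ℝ) :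
    ∑ i, ∑ j, 2 * frobInner (curv Γ i j x) (Dop Γ B i j x) =
      4 * ∑ i, ∑ j, frobInner (curv Γ i j x) (covDer Γ i (fun y => B y j) x) := by
  have e : ∑ i, ∑ j, frobInner (curv Γ i j x) (covDer Γ j (fun y => B y i) x) =
      - ∑ i, ∑ j, frobInner (curv Γ i j x) (covDer Γ i (fun y => B y j) x) := by
    rw [Finset.sum_comm]
    simp only [← Finset.sum_neg_distrib]
    refine Finset.sum_congr rfl fun i _ => Finset.sum_congr rfl fun j _ => ?_
    rw [curv_antisymm, fi_comm, fi_neg, fi_comm]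
  simp only [Dop, fi_sub, ← Finset.mul_sum, Finset.sum_sub_distrib]
  rw [e]; ring

lemma pointwise {Γ B : Conn n m} (h : Smooth Γ) (hmc : MetricCompat Γ) (hB : Smooth B)
    (x₀ : Fin n → ℝ) {t₀ : ℝ} (ht : 0 < t₀) (x : Fin n → ℝ) :
    (∑ i, ∑ j, 2 * frobInner (curv Γ i j x) (Dop Γ B i j x)) * gE x₀ t₀ x =
      4 * ((∑ k, frobInner (B x k) (dstarF Γ k x
        + ∑ i, ((x i - x₀ i) / (2 * t₀)) • curv Γ i k x)) * gE x₀ t₀ x)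
      + 4 * ∑ i, ∑ k, fderiv ℝ (fun y => frobInner (B y k) (curv Γ i k y) * gE x₀ t₀ y) x
        (Pi.single i 1) := by
  rw [c1_eq]
  have e1 : ∀ i k, fderiv ℝ (fun y => frobInner (B y k) (curv Γ i k y) * gE x₀ t₀ y) x
        (Pi.single i 1) = (frobInner (pder i (fun y => B y k) x) (curv Γ i k x) +
          frobInner (B x k) (pder i (fun y => curv Γ i k y) x)
          - (x i - x₀ i) / (2 * t₀) * frobInner (B x k) (curv Γ i k x)) * gE x₀ t₀ x := by
    intro i k
    have d1 := (contDiff_frobInner (hB k) (smooth_curv h i k)).differentiable (by simp) x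
    have d2 := (contDiff_gE x₀ t₀).differentiable (by simp) x
    rw [fderiv_fun_mul d1 d2]
    simp only [_root_.add_apply, _root_.smul_apply, smul_eq_mul]
    rw [hasFDerivAt_frobInner (hB k) (smooth_curv h i k), fderiv_gE x₀ ht]
    ring
  have e2 : ∑ k, frobInner (B x k) (dstarF Γ k x
        + ∑ i, ((x i - x₀ i) / (2 * t₀)) • curv Γ i k x) =
      ∑ i, ∑ k, (-frobInner (B x k) (covDer Γ i (fun y => curv Γ i k y) x) +
        (x i - x₀ i) / (2 * t₀) * frobInner (B x k) (curv Γ i k x)) := by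
    rw [Finset.sum_comm]
    refine Finset.sum_congr rfl fun k _ => ?_
    rw [fi_add, dstarF, fi_neg, fi_sum, fi_sum, Finset.sum_add_distrib, Finset.sum_neg_distrib]
    simp only [fi_smul]
  rw [e2]
  simp only [e1, ← Finset.sum_mul]
  rw [← mul_add, ← add_mul, mul_assoc]
  congr 2
  simp only [← Finset.sum_add_distrib]
  refine Finset.sum_congr rfl fun i _ => Finset.sum_congr rfl fun k _ => ?_
  simp only [covDer, fi_add]
  rw [fi_skew (hmc x i) (B x k), fi_comm (pder i (fun y => B y k) x)]
  ring

lemma ibp {Γ B : Conn n m} (h : Smooth Γ) (hmc : MetricCompat Γ) (hB : Smooth B)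
    (hBs : HasCompactSupport B) (x₀ : Fin n → ℝ) {t₀ : ℝ} (ht : 0 < t₀) :
    Integrable (fun x => (∑ i, ∑ j, 2 * frobInner (curv Γ i j x) (Dop Γ B i j x)) * gE x₀ t₀ x) ∧
    ∫ x, (∑ i, ∑ j, 2 * frobInner (curv Γ i j x) (Dop Γ B i j x)) * gE x₀ t₀ x =
      4 * ∫ x, (∑ k, frobInner (B x k) (dstarF Γ k x
        + ∑ i, ((x i - x₀ i) / (2 * t₀)) • curv Γ i k x)) * gE x₀ t₀ x := by
  have hi : Integrable (fun x => (∑ i, ∑ j, 2 * frobInner (curv Γ i j x) (Dop Γ B i j x)) *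
      gE x₀ t₀ x) := by
    apply Continuous.integrable_of_hasCompactSupport
    · refine Continuous.mul ?_ (contDiff_gE x₀ t₀).continuous
      exact continuous_finsetSum _ fun i _ => continuous_finsetSum _ fun j _ =>
        continuous_const.mul (contDiff_frobInner (smooth_curv h i j) (smooth_Dop h hB i j)).continuous
    · refine HasCompactSupport.intro hBs.isCompact fun x hx => ?_
      simp [Dop_zero hx, fi_zero]
  refine ⟨hi, ?_⟩
  have hX : ∀ i k, Integrable (fun x => fderiv ℝ (fun y => frobInner (B y k) (curv Γ i k y) *
      gE x₀ t₀ y) x (Pi.single i 1)) ∧ ∫ x, fderiv ℝ (fun y => frobInner (B y k) (curv Γ i k y) *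
      gE x₀ t₀ y) x (Pi.single i 1) = 0 := by
    intro i k
    refine integral_fderiv_zero ?_ ?_ _
    · exact (contDiff_frobInner (hB k) (smooth_curv h i k)).mul (contDiff_gE x₀ t₀)
    · refine HasCompactSupport.intro hBs.isCompact fun x hx => ?_
      simp [B_zero hx, fi_zero']
  have hXi : Integrable (fun x => 4 * ∑ i, ∑ k, fderiv ℝ (fun y => frobInner (B y k)
      (curv Γ i k y) * gE x₀ t₀ y) x (Pi.single i 1)) :=
    (integrable_finsetSum _ fun i _ => integrable_finsetSum _ fun k _ => (hX i k).1).const_mul 4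
  have hX0 : ∫ x, 4 * ∑ i, ∑ k, fderiv ℝ (fun y => frobInner (B y k)
      (curv Γ i k y) * gE x₀ t₀ y) x (Pi.single i 1) = 0 := by
    rw [integral_const_mul, integral_finsetSum _ fun i _ =>
      integrable_finsetSum _ fun k _ => (hX i k).1]
    rw [Finset.sum_eq_zero, mul_zero]
    intro i _
    rw [integral_finsetSum _ fun k _ => (hX i k).1]
    exact Finset.sum_eq_zero fun k _ => (hX i k).2
  rw [← integral_const_mul]
  have e : (fun x => 4 * ((∑ k, frobInner (B x k) (dstarF Γ k x
        + ∑ i, ((x i - x₀ i) / (2 * t₀)) • curv Γ i k x)) * gE x₀ t₀ x)) =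
      fun x => (∑ i, ∑ j, 2 * frobInner (curv Γ i j x) (Dop Γ B i j x)) * gE x₀ t₀ x -
        4 * ∑ i, ∑ k, fderiv ℝ (fun y => frobInner (B y k)
      (curv Γ i k y) * gE x₀ t₀ y) x (Pi.single i 1) := by
    funext x
    rw [pointwise h hmc hB x₀ ht x]; ring
  rw [e, integral_sub hi hXi, hX0, sub_zero]

end FV

set_option maxHeartbeats 1000000 in
/-- **First variation of the `ℱ`-functional** (Proposition `zYMfirstvar`). -/
theorem Ffunc_first_variation (n m : ℕ) (Γ : YM.Conn n m)
    (hsm : YM.Smooth Γ) (hmc : YM.MetricCompat Γ)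
    (hpoly : YM.PolyCurvGrowth Γ)
    (x₀ : Fin n → ℝ) (t₀ : ℝ) (ht₀ : 0 < t₀)
    (v : Fin n → ℝ) (τ : ℝ) (B : YM.Conn n m)
    (hBsm : YM.Smooth B) (hBsupp : HasCompactSupport B)
    (hBskew : YM.SkewVals B)
    (G₀ : (Fin n → ℝ) → ℝ)
    (hG₀ : G₀ = fun x => (4 * Real.pi * t₀) ^ (-(n : ℝ) / 2) *
      Real.exp (-(∑ i, (x i - x₀ i) ^ 2) / (4 * t₀))) :
    HasDerivAt (fun s : ℝ =>
        YM.Ffunc (fun x i => Γ x i + s • B x i) (x₀ + s • v) (t₀ + s * τ))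
      (τ * (∫ x : Fin n → ℝ,
            (t₀ * ((4 - (n : ℝ)) / 2) + (∑ i, (x i - x₀ i) ^ 2) / 4)
              * YM.normSqF Γ x * G₀ x)
        + t₀ * (∫ x : Fin n → ℝ,
            ((∑ i, v i * (x i - x₀ i)) / 2) * YM.normSqF Γ x * G₀ x)
        + 4 * t₀ ^ 2 * (∫ x : Fin n → ℝ,
            (∑ k, YM.frobInner (B x k)
              (YM.dstarF Γ k x
                + ∑ i, ((x i - x₀ i) / (2 * t₀)) • YM.curv Γ i k x)) * G₀ x))
      0 := by
  have hN0c : Continuous (YM.normSqF Γ) := by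
    have e : YM.normSqF Γ = fun x => ∑ i, ∑ j, YM.frobInner (YM.curv Γ i j x) (YM.curv Γ i j x) := by
      funext x; simp only [YM.normSqF, FV.frobSq_eq]
    rw [e]
    exact continuous_finsetSum _ fun i _ => continuous_finsetSum _ fun j _ =>
      (FV.contDiff_frobInner (FV.smooth_curv hsm i j) (FV.smooth_curv hsm i j)).continuous
  have hN0nn : ∀ x, 0 ≤ YM.normSqF Γ x := fun x =>
    Finset.sum_nonneg fun i _ => Finset.sum_nonneg fun j _ => Finset.sum_nonneg fun a _ =>
      Finset.sum_nonneg fun b _ => sq_nonneg _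
  have hN0 : FV.SubG (YM.normSqF Γ) := by
    obtain ⟨p, hp⟩ := hpoly
    refine ((FV.SubG.poly (n := n) p).pow 2).mono fun x => ?_
    have h1 := hp x
    have h2 : 0 ≤ YM.normF Γ x := Real.sqrt_nonneg _
    have h3 : YM.normF Γ x ^ 2 = YM.normSqF Γ x := Real.sq_sqrt (hN0nn x)
    rw [abs_of_nonneg (hN0nn x), abs_of_nonneg (sq_nonneg _), ← h3]
    exact pow_le_pow_left₀ h2 h1 2
  have hFD : ∀ i j, Continuous fun x => YM.frobInner (YM.curv Γ i j x) (YM.Dop Γ B i j x) :=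
    fun i j => (FV.contDiff_frobInner (FV.smooth_curv hsm i j) (FV.smooth_Dop hsm hBsm i j)).continuous
  have hDD : ∀ i j, Continuous fun x => YM.frobInner (YM.Dop Γ B i j x) (YM.Dop Γ B i j x) :=
    fun i j => (FV.contDiff_frobInner (FV.smooth_Dop hsm hBsm i j) (FV.smooth_Dop hsm hBsm i j)).continuous
  have hFC : ∀ i j, Continuous fun x => YM.frobInner (YM.curv Γ i j x) (YM.comm (B x i) (B x j)) :=
    fun i j => (FV.contDiff_frobInner (FV.smooth_curv hsm i j)
      (FV.smooth_comm (hBsm i) (hBsm j))).continuous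
  have hDC : ∀ i j, Continuous fun x => YM.frobInner (YM.Dop Γ B i j x) (YM.comm (B x i) (B x j)) :=
    fun i j => (FV.contDiff_frobInner (FV.smooth_Dop hsm hBsm i j)
      (FV.smooth_comm (hBsm i) (hBsm j))).continuous
  have hCC : ∀ i j, Continuous fun x =>
      YM.frobInner (YM.comm (B x i) (B x j)) (YM.comm (B x i) (B x j)) :=
    fun i j => (FV.contDiff_frobInner (FV.smooth_comm (hBsm i) (hBsm j))
      (FV.smooth_comm (hBsm i) (hBsm j))).continuous
  set c1 : (Fin n → ℝ) → ℝ := fun x =>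
    ∑ i, ∑ j, 2 * YM.frobInner (YM.curv Γ i j x) (YM.Dop Γ B i j x) with hc1
  set c2 : (Fin n → ℝ) → ℝ := fun x =>
    ∑ i, ∑ j, (YM.frobInner (YM.Dop Γ B i j x) (YM.Dop Γ B i j x) +
      2 * YM.frobInner (YM.curv Γ i j x) (YM.comm (B x i) (B x j))) with hc2
  set c3 : (Fin n → ℝ) → ℝ := fun x =>
    ∑ i, ∑ j, 2 * YM.frobInner (YM.Dop Γ B i j x) (YM.comm (B x i) (B x j)) with hc3
  set c4 : (Fin n → ℝ) → ℝ := fun x =>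
    ∑ i, ∑ j, YM.frobInner (YM.comm (B x i) (B x j)) (YM.comm (B x i) (B x j)) with hc4
  have k1 : Continuous c1 := continuous_finsetSum _ fun i _ => continuous_finsetSum _ fun j _ =>
      continuous_const.mul (hFD i j)
  have k2 : Continuous c2 := continuous_finsetSum _ fun i _ => continuous_finsetSum _ fun j _ =>
      (hDD i j).add (continuous_const.mul (hFC i j))
  have k3 : Continuous c3 := continuous_finsetSum _ fun i _ => continuous_finsetSum _ fun j _ =>
      continuous_const.mul (hDC i j)
  have k4 : Continuous c4 := continuous_finsetSum _ fun i _ => continuous_finsetSum _ fun j _ =>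
      hCC i j
  have hcomm : ∀ x, x ∉ tsupport B → ∀ i j, YM.comm (B x i) (B x j) = 0 := by
    intro x hx i j
    simp [FV.B_zero hx, YM.comm]
  have g1 : FV.SubG c1 := FV.subG_of_supp hBsupp k1 fun x hx => by
    simp [hc1, FV.Dop_zero hx, FV.fi_zero]
  have g2 : FV.SubG c2 := FV.subG_of_supp hBsupp k2 fun x hx => by
    simp [hc2, FV.Dop_zero hx, FV.fi_zero, hcomm x hx]
  have g3 : FV.SubG c3 := FV.subG_of_supp hBsupp k3 fun x hx => by
    simp [hc3, FV.Dop_zero hx, FV.fi_zero, hcomm x hx]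
  have g4 : FV.SubG c4 := FV.subG_of_supp hBsupp k4 fun x hx => by
    simp [hc4, FV.fi_zero, hcomm x hx]
  have hNexp : ∀ (s : ℝ) x, YM.normSqF (fun x i => Γ x i + s • B x i) x =
      YM.normSqF Γ x + s * c1 x + s ^ 2 * c2 x + s ^ 3 * c3 x + s ^ 4 * c4 x := by
    intro s x
    simp only [YM.normSqF, FV.curv_expand hsm hBsm, FV.frobSq_expand]
    simp only [hc1, hc2, hc3, hc4,
      Finset.sum_add_distrib, Finset.mul_sum, FV.frobSq_eq, mul_add]
  have dI := FV.deriv_integral hN0 g1 g2 g3 g4 hN0c k1 k2 k3 k4 x₀ v t₀ τ ht₀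
  set K : ℝ := (4 * Real.pi * t₀) ^ (-(n : ℝ) / 2) with hK
  have dt : HasDerivAt (fun s : ℝ => t₀ + s * τ) τ 0 := by
    simpa using ((hasDerivAt_id (0:ℝ)).mul_const τ).const_add t₀
  have dA : HasDerivAt (fun s : ℝ => (t₀ + s * τ) ^ 2 * (4 * Real.pi * (t₀ + s * τ)) ^ (-(n : ℝ) / 2))
      (τ * (t₀ * ((4 - (n : ℝ)) / 2)) * K) 0 := by
    have hpos : 0 < 4 * Real.pi * t₀ := by positivity
    have d1 := (dt.const_mul (4 * Real.pi)).rpow_const (p := -(n : ℝ) / 2)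
      (Or.inl (by simpa using hpos.ne'))
    refine ((dt.pow 2).mul d1).congr_deriv ?_
    simp only [zero_mul, add_zero, Pi.pow_apply]
    rw [Real.rpow_sub_one hpos.ne', ← hK]
    field_simp
    push_cast
    ring
  have dT := dA.mul dI
  have hL : FV.SubG (fun x : Fin n → ℝ => ∑ i, v i * (x i - x₀ i)) := FV.SubG.lin v x₀
  have hS : FV.SubG (fun x : Fin n → ℝ => ∑ i, (x i - x₀ i) ^ 2) := FV.SubG.quad x₀
  have i0 := hN0.integrable hN0c ht₀ x₀
  have i1 := (hN0.mul hL).integrable (by fun_prop) ht₀ x₀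
  have i2 := (hN0.mul hS).integrable (by fun_prop) ht₀ x₀
  obtain ⟨i3, hibp⟩ := FV.ibp hsm hmc hBsm hBsupp x₀ ht₀
  have hfun : (fun s : ℝ =>
        YM.Ffunc (fun x i => Γ x i + s • B x i) (x₀ + s • v) (t₀ + s * τ)) = 
      (fun s : ℝ => (t₀ + s * τ) ^ 2 * (4 * Real.pi * (t₀ + s * τ)) ^ (-(n : ℝ) / 2)) *
      (fun s : ℝ => ∫ x, (YM.normSqF Γ x + s * c1 x + s^2 * c2 x + s^3 * c3 x + s^4 * c4 x) *
        Real.exp (-(∑ i, (x i - (x₀ + s • v) i) ^ 2) / (4 * (t₀ + s * τ)))) := by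
    funext s
    simp only [YM.Ffunc, hNexp, Pi.mul_apply]
  rw [hfun]
  refine dT.congr_deriv ?_
  simp only [FV.gE] at hibp i3
  set e : (Fin n → ℝ) → ℝ := fun x => Real.exp (-(∑ i, (x i - x₀ i) ^ 2) / (4 * t₀)) with he
  replace i0 : Integrable (fun x => YM.normSqF Γ x * e x) := i0
  replace i1 : Integrable (fun x => YM.normSqF Γ x * (∑ i, v i * (x i - x₀ i)) * e x) := i1
  replace i2 : Integrable (fun x => YM.normSqF Γ x * (∑ i, (x i - x₀ i) ^ 2) * e x) := i2
  replace i3 : Integrable (fun x => c1 x * e x) := i3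
  replace hibp : ∫ x, c1 x * e x = 4 * ∫ x, (∑ k, YM.frobInner (B x k)
              (YM.dstarF Γ k x
                + ∑ i, ((x i - x₀ i) / (2 * t₀)) • YM.curv Γ i k x)) * e x := hibp
  have i13 : Integrable (fun x => c1 x * e x +
      1 / (2 * t₀) * (YM.normSqF Γ x * (∑ i, v i * (x i - x₀ i)) * e x)) := i3.add (i1.const_mul _)
  have hint : ∫ x, (c1 x + YM.normSqF Γ x * ((∑ i, v i * (x i - x₀ i)) / (2 * t₀) +
        (∑ i, (x i - x₀ i) ^ 2) * τ / (4 * t₀ ^ 2))) * e x =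
      (∫ x, c1 x * e x) + (1 / (2 * t₀)) * (∫ x, YM.normSqF Γ x * (∑ i, v i * (x i - x₀ i)) * e x)
        + (τ / (4 * t₀ ^ 2)) * (∫ x, YM.normSqF Γ x * (∑ i, (x i - x₀ i) ^ 2) * e x) := by
    rw [← integral_const_mul, ← integral_const_mul, ← integral_add i3 (i1.const_mul _),
      ← integral_add i13 (i2.const_mul _)]
    refine integral_congr_ae (Eventually.of_forall fun x => ?_)
    ring
  have t1 : ∫ x, (t₀ * ((4 - (n : ℝ)) / 2) + (∑ i, (x i - x₀ i) ^ 2) / 4)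
              * YM.normSqF Γ x * G₀ x =
      (t₀ * ((4 - (n : ℝ)) / 2) * K) * (∫ x, YM.normSqF Γ x * e x) +
      (K / 4) * (∫ x, YM.normSqF Γ x * (∑ i, (x i - x₀ i) ^ 2) * e x) := by
    rw [← integral_const_mul, ← integral_const_mul, ← integral_add (i0.const_mul _) (i2.const_mul _)]
    refine integral_congr_ae (Eventually.of_forall fun x => ?_)
    simp only [hG₀, he]
    ring
  have t2 : ∫ x, ((∑ i, v i * (x i - x₀ i)) / 2) * YM.normSqF Γ x * G₀ x =
      (K / 2) * (∫ x, YM.normSqF Γ x * (∑ i, v i * (x i - x₀ i)) * e x) := by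
    rw [← integral_const_mul]
    refine integral_congr_ae (Eventually.of_forall fun x => ?_)
    simp only [hG₀, he]
    ring
  have t3 : ∫ x, (∑ k, YM.frobInner (B x k)
              (YM.dstarF Γ k x
                + ∑ i, ((x i - x₀ i) / (2 * t₀)) • YM.curv Γ i k x)) * G₀ x =
      K * ∫ x, (∑ k, YM.frobInner (B x k)
              (YM.dstarF Γ k x
                + ∑ i, ((x i - x₀ i) / (2 * t₀)) • YM.curv Γ i k x)) * e x := by
    rw [← integral_const_mul]
    refine integral_congr_ae (Eventually.of_forall fun x => ?_)
    simp only [hG₀, he]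
    ring
  have hI0 : (∫ x, (YM.normSqF Γ x + 0 * c1 x + 0^2 * c2 x + 0^3 * c3 x + 0^4 * c4 x) *
        Real.exp (-(∑ i, (x i - (x₀ + (0:ℝ) • v) i) ^ 2) / (4 * (t₀ + 0 * τ)))) =
      ∫ x, YM.normSqF Γ x * e x := by
    simp [he]
  rw [hI0, hint, t1, t2, t3, hibp]
  simp only [zero_mul, add_zero, ← hK]
  generalize (∫ x, YM.normSqF Γ x * e x) = J0
  generalize (∫ x, YM.normSqF Γ x * (∑ i, v i * (x i - x₀ i)) * e x) = J1
  generalize (∫ x, YM.normSqF Γ x * (∑ i, (x i - x₀ i) ^ 2) * e x) = J2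
  generalize (∫ x, (∑ k, YM.frobInner (B x k)
              (YM.dstarF Γ k x
                + ∑ i, ((x i - x₀ i) / (2 * t₀)) • YM.curv Γ i k x)) * e x) = J3
  field_simp
  ring
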